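/- Let f ∈ S and F = Ψ(f). Let (f_t)_{t≥0} be a normalized Loewner chain on 𝔻 with f₀ = f, and set F_t := e^t·Ψ(e^{−t}·f_t) for t ≥ 0 (noting that e^{−t}·f_t ∈ S). If F is a support point of Ψ(S), then e^{−t}·F_t is a support point of Ψ(S) for every t ≥ 0. -/

import Mathlib

open Metric Filter Set

noncomputable section

/-- ℂⁿ with the Euclidean (Hermitian) norm. -/
abbrev En (n : ℕ) : Type := EuclideanSpace ℂ (Fin n)

/-- The open Euclidean unit ball 𝔹ₙ ⊂ ℂⁿ. -/
def Ball (n : ℕ) : Set (En n) := Metric.ball 0 1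

/-- The open unit disc 𝔻 ⊂ ℂ. -/
def Disc : Set ℂ := Metric.ball 0 1

/-- The class S: holomorphic injective f : 𝔻 → ℂ with f(0) = 0, f'(0) = 1. -/
def ClassS1 (f : ℂ → ℂ) : Prop :=
  DifferentiableOn ℂ f Disc ∧ Set.InjOn f Disc ∧ f 0 = 0 ∧ deriv f 0 = 1

/-- F is the Roper–Suffridge extension Ψ(f) of f, i.e.
F(z₁,z₂) = (f(z₁), z₂·√(f'(z₁))) on 𝔹₂, where √(f') is the holomorphic square
root of f' with value 1 at 0. -/
def IsRoperSuffridge (f : ℂ → ℂ) (F : En 2 → En 2) : Prop :=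
  ∃ g : ℂ → ℂ, DifferentiableOn ℂ g Disc ∧ g 0 = 1 ∧
    (∀ z ∈ Disc, g z ^ 2 = deriv f z) ∧
    (∀ z ∈ Ball 2, F z 0 = f (z 0) ∧ F z 1 = z 1 * g (z 0))

/-- Ψ(S) = {Ψ(f) : f ∈ S}. -/
def PsiS : Set (En 2 → En 2) :=
  {F | ∃ f : ℂ → ℂ, ClassS1 f ∧ IsRoperSuffridge f F}

/-- A ℂ-linear functional on maps 𝔹₂ → ℂ², continuous with respect to locally
uniform convergence on 𝔹₂ of holomorphic maps. -/
def IsContinuousLinearFunctional (L : (En 2 → En 2) → ℂ) : Prop :=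
  (∀ f g : En 2 → En 2, L (f + g) = L f + L g) ∧
  (∀ (c : ℂ) (f : En 2 → En 2), L (c • f) = c * L f) ∧
  (∀ (f : ℕ → En 2 → En 2) (g : En 2 → En 2),
    (∀ k, DifferentiableOn ℂ (f k) (Ball 2)) → DifferentiableOn ℂ g (Ball 2) →
    TendstoLocallyUniformlyOn f g atTop (Ball 2) →
    Tendsto (fun k => L (f k)) atTop (nhds (L g)))

/-- F is a support point of A ⊆ Hol(𝔹₂,ℂ²): F ∈ A and there is a continuous
ℂ-linear functional L whose real part is nonconstant on A and is maximized
over A at F. -/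
def IsSupportPoint (A : Set (En 2 → En 2)) (F : En 2 → En 2) : Prop :=
  F ∈ A ∧ ∃ L : (En 2 → En 2) → ℂ, IsContinuousLinearFunctional L ∧
    (∃ g₁ ∈ A, ∃ g₂ ∈ A, (L g₁).re ≠ (L g₂).re) ∧
    (∀ g ∈ A, (L g).re ≤ (L F).re)

/-- A normalized Loewner chain on 𝔻: holomorphic injective maps f_t with
f_t(0) = 0, f_t'(0) = eᵗ and increasing images. -/
def IsNormalizedLoewnerChain1 (f : ℝ → ℂ → ℂ) : Prop :=
  (∀ t, 0 ≤ t → DifferentiableOn ℂ (f t) Disc ∧ Set.InjOn (f t) Disc ∧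
    f t 0 = 0 ∧ deriv (f t) 0 = (Real.exp t : ℂ)) ∧
  (∀ s t, 0 ≤ s → s ≤ t → f s '' Disc ⊆ f t '' Disc)

theorem exists_holo_inverse {f : ℂ → ℂ} {U : Set ℂ} (hU : IsOpen U)
    (hf : DifferentiableOn ℂ f U) (hinj : Set.InjOn f U) :
    ∃ g : ℂ → ℂ, ∀ z ∈ U, g (f z) = z ∧ DifferentiableAt ℂ g (f z) := by
  classical
  set g := Function.invFunOn f U with hg
  have hgf : ∀ z ∈ U, g (f z) = z := fun z hz => hinj.leftInvOn_invFunOn hz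
  refine ⟨g, fun z₀ hz₀ => ⟨hgf z₀ hz₀, ?_⟩⟩
  have han : ∀ z ∈ U, AnalyticAt ℂ f z := fun z hz => hf.analyticAt (hU.mem_nhds hz)
  have hnc : ∀ z ∈ U, nhds (f z) ≤ Filter.map f (nhds z) := by
    intro z hz
    rcases (han z hz).eventually_constant_or_nhds_le_map_nhds with h | h
    · exfalso
      have h2 : ∀ᶠ w in nhds z, w = z := by
        filter_upwards [h, hU.mem_nhds hz] with w hw hwU
        exact hinj hwU hz hw
      have h3 : ∀ᶠ w in nhdsWithin z {z}ᶜ, w = z := h2.filter_mono nhdsWithin_le_nhds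
      have h4 : ∀ᶠ w in nhdsWithin z {z}ᶜ, w ≠ z := self_mem_nhdsWithin
      obtain ⟨w, hw, hw'⟩ := (h3.and h4).exists
      exact hw' hw
    · exact h
  have hcont : ∀ z ∈ U, ContinuousAt g (f z) := by
    intro z hz
    rw [ContinuousAt, hgf z hz]
    refine Tendsto.mono_left ?_ (hnc z hz)
    rw [tendsto_map'_iff]
    refine tendsto_id.congr' ?_
    filter_upwards [hU.mem_nhds hz] with w hw
    exact (hgf w hw).symm
  have hfg : ∀ z ∈ U, ∀ᶠ y in nhds (f z), f (g y) = y := by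
    intro z hz
    apply hnc z hz
    rw [Filter.mem_map]
    filter_upwards [hU.mem_nhds hz] with w hw
    simp [hgf w hw]
  have hd : ∀ z ∈ U, deriv f z ≠ 0 → DifferentiableAt ℂ g (f z) := by
    intro z hz h
    have : HasDerivAt f (deriv f z) (g (f z)) := by
      rw [hgf z hz]; exact (han z hz).differentiableAt.hasDerivAt
    exact (this.of_local_left_inverse (hcont z hz) h (hfg z hz)).differentiableAt
  have hiso : ∀ᶠ z in nhdsWithin z₀ {z₀}ᶜ, deriv f z ≠ 0 := by
    rcases (han z₀ hz₀).deriv.eventually_eq_zero_or_eventually_ne_zero with h | h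
    · exfalso
      obtain ⟨r, hr, hball⟩ := Metric.eventually_nhds_iff_ball.1
        (h.and (hU.mem_nhds hz₀))
      have hconst : ∀ w ∈ ball z₀ r, f w = f z₀ := by
        intro w hw
        refine (convex_ball z₀ r).is_const_of_fderivWithin_eq_zero (𝕜 := ℂ)
          (hf.mono fun x hx => (hball x hx).2) ?_ hw (mem_ball_self hr)
        intro x hx
        rw [fderivWithin_of_isOpen isOpen_ball hx]
        ext
        simpa using (hball x hx).1
      have hw : z₀ + (r/2 : ℝ) ∈ ball z₀ r := by
        simp [abs_of_pos hr]
        linarith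
      have := hinj (hball _ hw).2 hz₀ (hconst _ hw)
      simp at this
      exact hr.ne' this
    · exact h
  refine (Complex.analyticAt_of_differentiable_on_punctured_nhds_of_continuousAt ?_
    (hcont z₀ hz₀)).differentiableAt
  have h1 : Tendsto g (nhdsWithin (f z₀) {f z₀}ᶜ) (nhdsWithin z₀ {z₀}ᶜ) := by
    rw [tendsto_nhdsWithin_iff]
    refine ⟨?_, ?_⟩
    · have := (hcont z₀ hz₀).tendsto
      rw [hgf z₀ hz₀] at this
      exact this.mono_left nhdsWithin_le_nhds
    · filter_upwards [nhdsWithin_le_nhds (hfg z₀ hz₀), self_mem_nhdsWithin] with y hy hy' h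
      apply hy'
      rw [Set.mem_singleton_iff] at h ⊢
      rw [← hy, h]
  filter_upwards [h1.eventually hiso, h1.eventually (nhdsWithin_le_nhds (hU.mem_nhds hz₀)),
    nhdsWithin_le_nhds (hfg z₀ hz₀)] with y h2 h3 h4
  have := hd _ h3 h2
  rwa [h4] at this

theorem deriv_ne_zero_of_injOn {f : ℂ → ℂ} {U : Set ℂ} (hU : IsOpen U)
    (hf : DifferentiableOn ℂ f U) (hinj : Set.InjOn f U) {z : ℂ} (hz : z ∈ U) :
    deriv f z ≠ 0 := by
  obtain ⟨g, hg⟩ := exists_holo_inverse hU hf hinj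
  intro h0
  have h1 : HasDerivAt f 0 z := h0 ▸ (hf.differentiableAt (hU.mem_nhds hz)).hasDerivAt
  have h2 := (hg z hz).2.hasDerivAt.comp z h1
  have h3 : HasDerivAt (g ∘ f) 1 z := by
    refine (hasDerivAt_id z).congr_of_eventuallyEq ?_
    filter_upwards [hU.mem_nhds hz] with w hw
    exact (hg w hw).1
  simpa using h2.unique h3

/-- complement of the image of a closed disc is connected -/
theorem compl_image_preconnected {v : ℂ → ℂ} (hv : DifferentiableOn ℂ v Disc)
    (hinj : Set.InjOn v Disc) {r : ℝ} (hr0 : 0 < r) (hr : r < 1) :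
    IsPreconnected (v '' closedBall 0 r)ᶜ := by
  have hsub : closedBall (0:ℂ) r ⊆ Disc := closedBall_subset_ball hr
  have hcomp : IsCompact (v '' closedBall 0 r) :=
    (isCompact_closedBall 0 r).image_of_continuousOn (hv.continuousOn.mono hsub)
  have hopen : IsOpen (v '' closedBall 0 r)ᶜ := hcomp.isClosed.isOpen_compl
  set W := (v '' closedBall 0 r)ᶜ with hW
  set An : Set ℂ := Disc \ closedBall 0 r with hAn
  have hAnconn : IsPreconnected (v '' An) := by
    have : IsPreconnected An := by
      have h1 : An = (fun p : ℝ × ℂ => (p.1 : ℂ) * p.2) '' (Set.Ioo r 1 ×ˢ sphere (0:ℂ) 1) := by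
        ext z
        simp only [hAn, Disc, Set.mem_sdiff, mem_ball_zero_iff, mem_closedBall_zero_iff, not_le,
          Set.mem_image, Set.mem_prod, Set.mem_Ioo, mem_sphere_zero_iff_norm, Prod.exists]
        constructor
        · rintro ⟨h1, h2⟩
          have h3 : ‖z‖ ≠ 0 := (hr0.trans h2).ne'
          have h4 : (‖z‖ : ℂ) ≠ 0 := by exact_mod_cast h3
          refine ⟨‖z‖, z / ‖z‖, ⟨⟨h2, h1⟩, ?_⟩, ?_⟩
          · simp [h3]
          · field_simp
        · rintro ⟨a, b, ⟨⟨h1, h2⟩, h3⟩, rfl⟩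
          rw [norm_mul, h3, mul_one, Complex.norm_real, Real.norm_of_nonneg (hr0.trans h1).le]
          exact ⟨h2, h1⟩
      rw [h1]
      refine (isPreconnected_Ioo.prod ?_).image _ (by fun_prop)
      exact isPreconnected_sphere (by simp [Complex.rank_real_complex]) _ _
    exact this.image _ (hv.continuousOn.mono Set.sdiff_subset)
  have hAnW : v '' An ⊆ W := by
    rintro _ ⟨z, hz, rfl⟩ ⟨w, hw, hwz⟩
    have := hinj (hsub hw) hz.1 hwz
    exact hz.2 (this ▸ hw)
  have hvopen : IsOpen (v '' Disc) := by
    obtain ⟨g, hg⟩ := exists_holo_inverse isOpen_ball hv hinj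
    rcases (hv.analyticOnNhd isOpen_ball).is_constant_or_isOpen
      (convex_ball 0 1).isPreconnected with h | h
    · exfalso
      obtain ⟨w, hw⟩ := h
      have h0 : (0:ℂ) ∈ ball (0:ℂ) 1 := by simp
      have h1 : (1/2:ℂ) ∈ ball (0:ℂ) 1 := by simp; norm_num
      have := hinj h1 h0 ((hw _ h1).trans (hw _ h0).symm)
      norm_num at this
    · exact h _ (subset_refl _) isOpen_ball
  -- any open piece avoiding v(An) with relatively open complement is empty
  have key : ∀ Y Z : Set ℂ, IsOpen Y → IsOpen Z → W ⊆ Y ∪ Z → W ∩ (Y ∩ Z) = ∅ →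
      v '' An ∩ Y = ∅ → W ∩ Y = ∅ := by
    intro Y Z hY hZ hcov hdis hem
    have hcl : IsClopen (W ∩ Y) := by
      refine ⟨?_, hopen.inter hY⟩
      rw [← isOpen_compl_iff]
      have : (W ∩ Y)ᶜ = (v '' Disc \ v '' An)  ∪ (W ∩ Z) ∪ v '' Disc:= by
        ext x
        constructor
        · intro hx
          by_cases hxW : x ∈ W
          · left; right
            refine ⟨hxW, ?_⟩
            rcases hcov hxW with h | h
            · exact absurd ⟨hxW, h⟩ hx
            · exact h
          · right
            rw [hW, Set.mem_compl_iff, not_not] at hxW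
            exact Set.image_mono hsub hxW
        · have hD : x ∈ v '' Disc → x ∈ (W ∩ Y)ᶜ := by
            rintro ⟨z, hz, rfl⟩ ⟨h1, h2⟩
            by_cases hzz : z ∈ closedBall (0:ℂ) r
            · exact h1 ⟨z, hzz, rfl⟩
            · exact (Set.eq_empty_iff_forall_notMem.1 hem) _ ⟨⟨z, ⟨hz, hzz⟩, rfl⟩, h2⟩
          rintro ((h | h) | h)
          · exact hD h.1
          · rintro ⟨h1, h2⟩
            exact (Set.eq_empty_iff_forall_notMem.1 hdis) x ⟨h1, h2, h.2⟩
          · exact hD h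
      rw [this, Set.union_right_comm, Set.union_eq_self_of_subset_left Set.sdiff_subset]
      exact hvopen.union (hopen.inter hZ)
    rcases isClopen_iff.1 hcl with h | h
    · exact h
    · exfalso
      have : v 0 ∈ W ∩ Y := h ▸ Set.mem_univ _
      exact this.1 ⟨0, by simp [hr0.le], rfl⟩
  rw [isPreconnected_iff_subset_of_disjoint]
  intro Y Z hY hZ hcov hdis
  rcases isPreconnected_iff_subset_of_disjoint.1 hAnconn Y Z hY hZ (hAnW.trans hcov)
    (by rw [← Set.subset_empty_iff, ← hdis]; exact Set.inter_subset_inter_left _ hAnW) with h | h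
  · left
    have h2 := key Z Y hZ hY (by rwa [Set.union_comm]) (by rwa [Set.inter_comm Z Y]) (by
      rw [Set.eq_empty_iff_forall_notMem]
      rintro x ⟨h1, h3⟩
      exact (Set.eq_empty_iff_forall_notMem.1 hdis) x ⟨hAnW h1, h h1, h3⟩)
    intro x hx
    rcases hcov hx with h' | h'
    · exact h'
    · exact absurd ⟨hx, h'⟩ ((Set.eq_empty_iff_forall_notMem.1 h2) x)
  · right
    have h2 := key Y Z hY hZ hcov hdis (by
      rw [Set.eq_empty_iff_forall_notMem]
      rintro x ⟨h1, h3⟩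
      exact (Set.eq_empty_iff_forall_notMem.1 hdis) x ⟨hAnW h1, h3, h h1⟩)
    intro x hx
    rcases hcov hx with h' | h'
    · exact absurd ⟨hx, h'⟩ ((Set.eq_empty_iff_forall_notMem.1 h2) x)
    · exact h'

theorem cauchy_univalent {v g : ℂ → ℂ} (hv : DifferentiableOn ℂ v Disc)
    (hinj : Set.InjOn v Disc) (hg : DifferentiableOn ℂ g Disc) {ρ : ℝ} (hρ : ρ < 1)
    {z : ℂ} (hz : z ∈ ball (0:ℂ) ρ) :
    (∮ ζ in C(0, ρ), (g ζ * deriv v ζ) * (v ζ - v z)⁻¹) = (2 * Real.pi * Complex.I) * g z := by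
  have hzD : z ∈ Disc := ball_subset_ball hρ.le hz
  have hopen : IsOpen Disc := isOpen_ball
  have hsub : closedBall (0:ℂ) ρ ⊆ Disc := closedBall_subset_ball hρ
  have hds : DifferentiableOn ℂ (dslope v z) Disc :=
    (Complex.differentiableOn_dslope (hopen.mem_nhds hzD)).2 hv
  have hdn : ∀ ζ ∈ Disc, dslope v z ζ ≠ 0 := by
    intro ζ hζ
    rcases eq_or_ne ζ z with rfl | hne
    · rw [dslope_same]; exact deriv_ne_zero_of_injOn hopen hv hinj hζ
    · rw [dslope_of_ne _ hne, slope_def_field]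
      exact div_ne_zero (sub_ne_zero.2 fun h => hne (hinj hζ hzD h)) (sub_ne_zero.2 hne)
  have hq : DifferentiableOn ℂ (fun ζ => g ζ * deriv v ζ / dslope v z ζ) Disc :=
    (hg.mul (hv.deriv hopen)).div hds hdn
  have := (hq.mono hsub).circleIntegral_sub_inv_smul hz
  simp only [smul_eq_mul, dslope_same] at this
  rw [mul_div_assoc, div_self (deriv_ne_zero_of_injOn hopen hv hinj hzD), mul_one] at this
  rw [← this]
  refine circleIntegral.integral_congr (pos_of_mem_ball hz).le ?_
  intro ζ hζ
  have hne : ζ ≠ z := by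
    rintro rfl
    simp at hζ hz
    exact hz.ne hζ
  have h1 : ζ - z ≠ 0 := sub_ne_zero.2 hne
  have h2 : v ζ - v z ≠ 0 := sub_ne_zero.2 fun h => hne (hinj (hsub (sphere_subset_closedBall hζ)) hzD h)
  simp only [dslope_of_ne _ hne, slope_def_field]
  field_simp

theorem poly_dense {v g : ℂ → ℂ} (hv : DifferentiableOn ℂ v Disc)
    (hinj : Set.InjOn v Disc) (hg : DifferentiableOn ℂ g Disc) {r : ℝ} (hr0 : 0 < r) (hr : r < 1)
    {ε : ℝ} (hε : 0 < ε) :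
    ∃ p : Polynomial ℂ, ∀ z ∈ closedBall (0:ℂ) r, ‖p.eval (v z) - g z‖ < ε := by
  have hopen : IsOpen Disc := isOpen_ball
  obtain ⟨ρ, hrρ, hρ⟩ := exists_between hr
  have hρ0 : 0 < ρ := hr0.trans hrρ
  have hsubr : closedBall (0:ℂ) r ⊆ Disc := closedBall_subset_ball hr
  have hsubρ : closedBall (0:ℂ) ρ ⊆ Disc := closedBall_subset_ball hρ
  let K : Set ℂ := closedBall 0 r
  have : CompactSpace K := isCompact_iff_compactSpace.1 (isCompact_closedBall 0 r)
  let V : C(K, ℂ) := ⟨fun z => v z, (hv.continuousOn.mono hsubr).comp_continuous continuous_subtype_val fun z => z.2⟩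
  let A := Algebra.elemental ℂ V
  let x : A := ⟨V, Algebra.elemental.self_mem ℂ V⟩
  have hspecV : spectrum ℂ V = v '' K := by
    rw [ContinuousMap.spectrum_eq_range]
    ext y
    constructor
    · rintro ⟨z, rfl⟩
      exact ⟨z, z.2, rfl⟩
    · rintro ⟨z, hz, rfl⟩
      exact ⟨⟨z, hz⟩, rfl⟩
  have hspec : spectrum ℂ x = v '' K := by
    rw [← hspecV]
    refine Subalgebra.spectrum_eq_of_isPreconnected_compl A x ?_
    change IsPreconnected (spectrum ℂ V)ᶜ
    rw [hspecV]
    exact compl_image_preconnected hv hinj hr0 hr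
  let ev : ∀ z : K, A →L[ℂ] ℂ := fun z =>
    (ContinuousMap.evalCLM ℂ z).comp (Subalgebra.toSubmodule A).subtypeL
  have hres : ∀ ζ ∈ sphere (0:ℂ) ρ, v ζ ∈ resolventSet ℂ x := by
    intro ζ hζ
    have : v ζ ∉ spectrum ℂ x := by
      rw [hspec]
      rintro ⟨w, hw, hwz⟩
      have := hinj (hsubr hw) (hsubρ (sphere_subset_closedBall hζ)) hwz
      subst this
      simp [K] at hw hζ
      linarith
    simpa [spectrum] using this
  let Φ : ℂ → A := fun ζ => (g ζ * deriv v ζ) • resolvent x (v ζ)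
  have hΦ : ContinuousOn Φ (sphere (0:ℂ) ρ) := by
    have hs : sphere (0:ℂ) ρ ⊆ Disc := sphere_subset_closedBall.trans hsubρ
    refine ContinuousOn.fun_smul ?_ ?_
    · exact (hg.continuousOn.mono hs).mul ((hv.deriv hopen).continuousOn.mono hs)
    · intro ζ hζ
      have h1 : ContinuousAt (resolvent x) (v ζ) :=
        (spectrum.hasDerivAt_resolvent (hres ζ hζ)).continuousAt
      exact h1.comp_continuousWithinAt (f := v) ((hv.continuousOn.mono hs) ζ hζ)
  have hci : CircleIntegrable Φ 0 ρ := hΦ.circleIntegrable hρ0.le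
  have hevR : ∀ (z : K), ∀ ζ ∈ sphere (0:ℂ) ρ, ev z (resolvent x (v ζ)) = (v ζ - v z)⁻¹ := by
    intro z ζ hζ
    have h1 : (algebraMap ℂ A (v ζ) - x) * resolvent x (v ζ) = 1 :=
      Ring.mul_inverse_cancel _ (hres ζ hζ)
    have h2 := congrArg (fun a : A => (a : C(K, ℂ)) z) h1
    have h3 : (v ζ - v z) * ev z (resolvent x (v ζ)) = 1 := h2
    exact eq_inv_of_mul_eq_one_right h3
  let J : A := (2 * Real.pi * Complex.I : ℂ)⁻¹ • ∮ ζ in C(0, ρ), Φ ζ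
  have hpi : (2 * Real.pi * Complex.I : ℂ) ≠ 0 := Complex.two_pi_I_ne_zero
  have hJ : ∀ z : K, (J : C(K, ℂ)) z = g z := by
    intro z
    have h0 : (J : C(K, ℂ)) z = ev z J := rfl
    have h1 : ev z (∮ ζ in C(0, ρ), Φ ζ) = ∮ ζ in C(0, ρ), ev z (Φ ζ) := by
      simp only [circleIntegral]
      rw [← ContinuousLinearMap.intervalIntegral_comp_comm]
      · simp
      · exact hci.out
    rw [h0, map_smul, h1]
    have h2 : (∮ ζ in C(0, ρ), ev z (Φ ζ)) =
        ∮ ζ in C(0, ρ), (g ζ * deriv v ζ) * (v ζ - v z)⁻¹ := by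
      refine circleIntegral.integral_congr hρ0.le ?_
      intro ζ hζ
      simp only [Φ, map_smul, smul_eq_mul]
      rw [hevR z ζ hζ]
    rw [h2, cauchy_univalent hv hinj hg hρ (closedBall_subset_ball hrρ z.2), smul_eq_mul,
      inv_mul_cancel_left₀ hpi]
  have hJcl : (J : C(K, ℂ)) ∈ closure (Algebra.adjoin ℂ {V} : Set C(K, ℂ)) := J.2
  obtain ⟨b, hb, hbd⟩ := Metric.mem_closure_iff.1 hJcl ε hε
  rw [SetLike.mem_coe, Algebra.adjoin_singleton_eq_range_aeval] at hb
  obtain ⟨p, rfl⟩ := hb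
  refine ⟨p, fun z hz => ?_⟩
  have h1 := (ContinuousMap.dist_lt_iff hε).1 hbd ⟨z, hz⟩
  rw [dist_comm, dist_eq_norm, hJ] at h1
  have h2 : (Polynomial.aeval V p) ⟨z, hz⟩ = p.eval (v z) := by
    have := Polynomial.aeval_algHom_apply (ContinuousMap.evalAlgHom ℂ ℂ (⟨z, hz⟩ : K)) V p
    rw [← Polynomial.coe_aeval_eq_eval]
    exact this.symm
  change ‖(Polynomial.aeval V p) ⟨z, hz⟩ - g z‖ < ε at h1
  rwa [h2] at h1

theorem exists_poly_seq {v g : ℂ → ℂ} (hv : DifferentiableOn ℂ v Disc)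
    (hinj : Set.InjOn v Disc) (hg : DifferentiableOn ℂ g Disc) :
    ∃ p : ℕ → Polynomial ℂ,
      TendstoLocallyUniformlyOn (fun k z => (p k).eval (v z)) g atTop Disc := by
  have h := fun k : ℕ => poly_dense hv hinj hg (r := 1 - 1 / ((k:ℝ) + 2))
    (by have : (0:ℝ) ≤ k := k.cast_nonneg
        rw [sub_pos, div_lt_one (by positivity)]; linarith)
    (by have : (0:ℝ) < 1 / ((k:ℝ)+2) := by positivity
        linarith) (ε := 1 / ((k:ℝ) + 1)) (by positivity)
  choose p hp using h
  refine ⟨p, ?_⟩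
  have hopen : IsOpen Disc := isOpen_ball
  rw [tendstoLocallyUniformlyOn_iff_forall_isCompact hopen]
  intro C hC hCc
  obtain ⟨s, hs0, hs⟩ : ∃ s : ℝ, s < 1 ∧ C ⊆ closedBall 0 s := by
    rcases C.eq_empty_or_nonempty with rfl | hne
    · exact ⟨0, by norm_num, by simp⟩
    · obtain ⟨m, hm, hmax⟩ := hCc.exists_isMaxOn hne continuous_norm.continuousOn
      refine ⟨‖m‖, by simpa [Disc] using hC hm, fun w hw => by simpa using hmax hw⟩
  rw [Metric.tendstoUniformlyOn_iff]
  intro ε hε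
  have t1 : Tendsto (fun k : ℕ => 1 - 1 / ((k:ℝ) + 2)) atTop (nhds 1) := by
    have : Tendsto (fun k : ℕ => 1 / ((k:ℝ) + 2)) atTop (nhds 0) := by
      have := (tendsto_const_nhds (x := (1:ℝ))).div_atTop
        (tendsto_atTop_add_const_right atTop (2:ℝ) tendsto_natCast_atTop_atTop)
      simpa using this
    simpa using this.const_sub 1
  filter_upwards [t1.eventually_const_le hs0,
    (tendsto_one_div_add_atTop_nhds_zero_nat (𝕜 := ℝ)).eventually_lt_const hε] with k h1 h2 w hw
  rw [dist_comm, dist_eq_norm]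
  exact (hp k w (closedBall_subset_closedBall h1 (hs hw))).trans h2

/-- The maps `(z₁, z₂) ↦ (a z₁, z₂ * b z₁)`. -/
def EE (a b : ℂ → ℂ) : En 2 → En 2 := fun z => !₂[a (z 0), z 1 * b (z 0)]

theorem EE_zero_apply (a b : ℂ → ℂ) (z : En 2) : EE a b z 0 = a (z 0) := by simp [EE]

theorem EE_one_apply (a b : ℂ → ℂ) (z : En 2) : EE a b z 1 = z 1 * b (z 0) := by simp [EE]

theorem En2_ext {x y : En 2} (h0 : x 0 = y 0) (h1 : x 1 = y 1) : x = y := by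
  ext i; fin_cases i
  · exact h0
  · exact h1

theorem EE_add (a b a' b' : ℂ → ℂ) : EE (a + a') (b + b') = EE a b + EE a' b' := by
  funext z
  apply En2_ext
  · simp [EE]
  · simp [EE, mul_add]

theorem EE_smul (c : ℂ) (a b : ℂ → ℂ) : EE (c • a) (c • b) = c • EE a b := by
  funext z
  apply En2_ext
  · simp [EE]
  · simp [EE, mul_left_comm]

theorem mem_Ball2 {z : En 2} : z ∈ Ball 2 ↔ ‖z 0‖ ^ 2 + ‖z 1‖ ^ 2 < 1 := by
  rw [Ball, mem_ball_zero_iff, ← sq_lt_one_iff₀ (norm_nonneg z), EuclideanSpace.norm_sq_eq]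
  simp

theorem coord0_mem {z : En 2} (hz : z ∈ Ball 2) : z 0 ∈ Disc := by
  rw [mem_Ball2] at hz
  rw [Disc, mem_ball_zero_iff, ← sq_lt_one_iff₀ (norm_nonneg _)]
  nlinarith [sq_nonneg ‖z 1‖]

theorem coord1_lt {z : En 2} (hz : z ∈ Ball 2) : ‖z 1‖ < 1 := by
  rw [mem_Ball2] at hz
  rw [← sq_lt_one_iff₀ (norm_nonneg _)]
  nlinarith [sq_nonneg ‖z 0‖]

theorem norm_En2_le (z : En 2) : ‖z‖ ≤ ‖z 0‖ + ‖z 1‖ := by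
  rw [EuclideanSpace.norm_eq]
  apply Real.sqrt_le_iff.2
  refine ⟨by positivity, ?_⟩
  simp
  nlinarith [norm_nonneg (z 0), norm_nonneg (z 1)]

theorem EE_diff {a b : ℂ → ℂ} (ha : DifferentiableOn ℂ a Disc) (hb : DifferentiableOn ℂ b Disc) :
    DifferentiableOn ℂ (EE a b) (Ball 2) := by
  rw [differentiableOn_euclidean]
  have hp : ∀ i : Fin 2, DifferentiableOn ℂ (fun z : En 2 => z i) (Ball 2) := by
    intro i
    exact (EuclideanSpace.proj (𝕜 := ℂ) i).differentiable.differentiableOn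
  have ha' : DifferentiableOn ℂ (fun z : En 2 => a (z 0)) (Ball 2) :=
    ha.comp (hp 0) fun z hz => coord0_mem hz
  have hb' : DifferentiableOn ℂ (fun z : En 2 => b (z 0)) (Ball 2) :=
    hb.comp (hp 0) fun z hz => coord0_mem hz
  intro i
  fin_cases i
  · exact ha'
  · exact (hp 1).mul hb'

theorem EE_tendsto {a b : ℂ → ℂ} {ak bk : ℕ → ℂ → ℂ}
    (ha : TendstoLocallyUniformlyOn ak a atTop Disc)
    (hb : TendstoLocallyUniformlyOn bk b atTop Disc) :
    TendstoLocallyUniformlyOn (fun k => EE (ak k) (bk k)) (EE a b) atTop (Ball 2) := by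
  rw [Metric.tendstoLocallyUniformlyOn_iff] at ha hb ⊢
  intro ε hε x hx
  obtain ⟨s, hs, hsa⟩ := ha (ε/2) (by positivity) (x 0) (coord0_mem hx)
  obtain ⟨t, ht, htb⟩ := hb (ε/2) (by positivity) (x 0) (coord0_mem hx)
  have hc : Tendsto (fun z : En 2 => z 0) (nhdsWithin x (Ball 2)) (nhdsWithin (x 0) Disc) := by
    rw [tendsto_nhdsWithin_iff]
    refine ⟨?_, ?_⟩
    · exact ((EuclideanSpace.proj (𝕜 := ℂ) (0 : Fin 2)).continuous.tendsto x).mono_left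
        nhdsWithin_le_nhds
    · filter_upwards [self_mem_nhdsWithin] with z hz using coord0_mem hz
  refine ⟨((fun z : En 2 => z 0) ⁻¹' s ∩ (fun z : En 2 => z 0) ⁻¹' t) ∩ Ball 2,
    inter_mem (inter_mem (hc hs) (hc ht)) self_mem_nhdsWithin, ?_⟩
  filter_upwards [hsa, htb] with k h1 h2 y hy
  have h3 := h1 (y 0) hy.1.1
  have h4 := h2 (y 0) hy.1.2
  rw [dist_eq_norm] at h3 h4 ⊢
  refine (norm_En2_le _).trans_lt ?_
  simp only [PiLp.sub_apply, EE_zero_apply, EE_one_apply]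
  rw [← mul_sub, norm_mul]
  nlinarith [coord1_lt hy.2, norm_nonneg (y 1), norm_nonneg (b (y 0) - bk k (y 0))]

theorem L_congr {L : (En 2 → En 2) → ℂ} (hL : IsContinuousLinearFunctional L)
    {F G : En 2 → En 2} (hG : DifferentiableOn ℂ G (Ball 2)) (h : ∀ z ∈ Ball 2, F z = G z) :
    L F = L G := by
  have hF : DifferentiableOn ℂ F (Ball 2) := hG.congr h
  have h1 := hL.2.2 (fun _ => F) G (fun _ => hF) hG (by
    rw [Metric.tendstoLocallyUniformlyOn_iff]
    intro ε hε x hx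
    refine ⟨Ball 2, self_mem_nhdsWithin, Eventually.of_forall fun k y hy => ?_⟩
    rw [h y hy]; simpa using hε)
  exact tendsto_nhds_unique tendsto_const_nhds h1

theorem L_EE_congr {L : (En 2 → En 2) → ℂ} (hL : IsContinuousLinearFunctional L)
    {a b a' b' : ℂ → ℂ} (ha : DifferentiableOn ℂ a' Disc) (hb : DifferentiableOn ℂ b' Disc)
    (h : ∀ z ∈ Disc, a z = a' z) (h' : ∀ z ∈ Disc, b z = b' z) :
    L (EE a b) = L (EE a' b') := by
  refine L_congr hL (EE_diff ha hb) fun z hz => ?_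
  simp only [EE, h _ (coord0_mem hz), h' _ (coord0_mem hz)]

theorem PsiS_intro {f g : ℂ → ℂ} (hf : ClassS1 f) (hg : DifferentiableOn ℂ g Disc)
    (hg0 : g 0 = 1) (hgf : ∀ z ∈ Disc, g z ^ 2 = deriv f z) : EE f g ∈ PsiS :=
  ⟨f, hf, g, hg, hg0, hgf, fun z _ => ⟨EE_zero_apply _ _ _, EE_one_apply _ _ _⟩⟩

theorem L_RS {L : (En 2 → En 2) → ℂ} (hL : IsContinuousLinearFunctional L)
    {f g : ℂ → ℂ} {F : En 2 → En 2} (hf : DifferentiableOn ℂ f Disc)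
    (hg : DifferentiableOn ℂ g Disc)
    (h : ∀ z ∈ Ball 2, F z 0 = f (z 0) ∧ F z 1 = z 1 * g (z 0)) : L F = L (EE f g) := by
  refine L_congr hL (EE_diff hf hg) fun z hz => En2_ext ?_ ?_
  · rw [(h z hz).1, EE_zero_apply]
  · rw [(h z hz).2, EE_one_apply]

theorem coeff_zero_of_re_const {e : ℕ → ℂ} {φ : ℂ → ℂ} {C : ℝ}
    (h : ∀ ε : ℂ, ‖ε‖ < 1 →
      Tendsto (fun N => ∑ m ∈ Finset.range N, e m * ε ^ m) atTop (nhds (φ ε)))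
    (hre : ∀ ε : ℂ, ‖ε‖ < 1 → (φ ε).re = C) : ∀ m, 1 ≤ m → e m = 0 := by
  set p := FormalMultilinearSeries.ofScalars ℂ e with hp
  have hterm : Tendsto (fun n => e n * (1/2 : ℂ) ^ n) atTop (nhds 0) := by
    have h1 := h (1/2) (by norm_num)
    have h2 := ((tendsto_add_atTop_iff_nat 1).2 h1).sub h1
    simpa [Finset.sum_range_succ] using h2
  have hrad : (((1/2 : NNReal)) : ENNReal) ≤ p.radius := by
    refine p.le_radius_of_tendsto (l := 0) ?_
    have := hterm.norm
    simpa [hp, FormalMultilinearSeries.ofScalars_norm] using this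
  have hps := (p.hasFPowerSeriesOnBall (lt_of_lt_of_le (by simp) hrad)).mono
    (r' := ((1/2 : NNReal) : ENNReal)) (by simp) hrad
  have hsum : ∀ ε ∈ ball (0:ℂ) (1/2), p.sum ε = φ ε := by
    intro ε hε
    have h1 : ε ∈ Metric.eball (0:ℂ) ((1/2 : NNReal) : ENNReal) := by
      rw [Metric.eball_coe]; simpa using hε
    have h2 := (hps.hasSum h1).tendsto_sum_nat
    rw [zero_add] at h2
    refine tendsto_nhds_unique h2 ?_
    have h3 := h ε (by simp at hε; linarith)
    refine h3.congr fun N => Finset.sum_congr rfl fun m _ => ?_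
    simp [hp]
    ring
  have hball : Metric.eball (0:ℂ) ((1/2 : NNReal) : ENNReal) = ball (0:ℂ) (1/2) := by
    rw [Metric.eball_coe]; simp
  have han : AnalyticOnNhd ℂ p.sum (ball (0:ℂ) (1/2)) := by
    rw [← hball]; exact hps.analyticOnNhd
  obtain ⟨c, hc⟩ := han.eq_const_of_re_eq_const (c₀ := C) (by
    intro x hx
    rw [hsum x hx]
    exact hre x (by simp at hx; linarith)) isOpen_ball
    ((convex_ball _ _).isConnected ⟨0, by simp⟩)
  have h1 : HasFPowerSeriesAt (fun _ => c) p (0:ℂ) := by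
    refine hps.hasFPowerSeriesAt.congr ?_
    filter_upwards [ball_mem_nhds (0:ℂ) (by norm_num : (0:ℝ) < 1/2)] with x hx using hc x hx
  have h2 := h1.eq_formalMultilinearSeries (hasFPowerSeriesAt_const (c := c))
  intro m hm
  have h3 : p m = 0 := by
    rw [h2, constFormalMultilinearSeries_apply_of_nonzero (by omega)]
  rwa [hp, FormalMultilinearSeries.ofScalars_eq_zero] at h3

/-- binomial coefficients of the square root -/
def cc (m : ℕ) : ℂ := Ring.choose (2⁻¹ : ℂ) m

theorem cc_ne_zero (m : ℕ) : cc m ≠ 0 := by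
  intro h
  have h1 := Ring.descPochhammer_eq_factorial_smul_choose (2⁻¹ : ℂ) m
  rw [show Ring.choose (2⁻¹ : ℂ) m = 0 from h, smul_zero, ← Polynomial.aeval_eq_smeval, Polynomial.aeval_def,
    Polynomial.eval₂_eq_eval_map, descPochhammer_map, descPochhammer_eval_eq_prod_range,
    Finset.prod_eq_zero_iff] at h1
  obtain ⟨i, _, hi⟩ := h1
  have h2 : (1 : ℂ) = 2 * i := by
    rw [← sub_eq_zero.1 hi]; norm_num
  have h3 : (1 : ℕ) = 2 * i := by exact_mod_cast h2
  omega

theorem cc_zero : cc 0 = 1 := by simp [cc]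
theorem cc_one : cc 1 = 2⁻¹ := by simp [cc]

theorem sqrt_series : TendstoLocallyUniformlyOn
    (fun N (x : ℂ) => ∑ m ∈ Finset.range N, cc m * x ^ m) (fun x => (1 + x) ^ (2⁻¹ : ℂ))
    atTop Disc := by
  have h := (Complex.one_add_cpow_hasFPowerSeriesOnBall_zero (a := (2⁻¹ : ℂ))).tendstoLocallyUniformlyOn'
  have hb : Metric.eball (0:ℂ) 1 = Disc := by
    rw [← ENNReal.coe_one, Metric.eball_coe]; simp [Disc]
  rw [hb] at h
  refine h.congr ?_
  intro N x hx
  simp [FormalMultilinearSeries.partialSum, binomialSeries, cc, mul_comm]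

theorem sqrt_diff : DifferentiableOn ℂ (fun x : ℂ => (1 + x) ^ (2⁻¹ : ℂ)) Disc := by
  have h := (Complex.one_add_cpow_hasFPowerSeriesOnBall_zero (a := (2⁻¹ : ℂ))).differentiableOn
  have hb : Metric.eball (0:ℂ) 1 = Disc := by
    rw [← ENNReal.coe_one, Metric.eball_coe]; simp [Disc]
  rwa [hb] at h

theorem maps_eps {ε : ℂ} (hε : ‖ε‖ < 1) {j : ℕ} :
    MapsTo (fun z : ℂ => ε * z ^ j) Disc Disc := by
  intro z hz
  simp only [Disc, mem_ball_zero_iff] at hz ⊢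
  rw [norm_mul, norm_pow]
  calc ‖ε‖ * ‖z‖ ^ j ≤ ‖ε‖ * 1 := by gcongr; exact pow_le_one₀ (norm_nonneg _) hz.le
    _ < 1 := by simpa using hε

theorem test_mem {ε : ℂ} (hε : ‖ε‖ < 1) {j : ℕ} (hj : 1 ≤ j) :
    EE (fun z => z + ε / (j + 1) * z ^ (j + 1)) (fun z => (1 + ε * z ^ j) ^ (2⁻¹ : ℂ)) ∈ PsiS := by
  have hj1 : (j + 1 : ℂ) ≠ 0 := by exact_mod_cast Nat.succ_ne_zero j
  have hder : ∀ z, HasDerivAt (fun z => z + ε / (j + 1) * z ^ (j + 1)) (1 + ε * z ^ j) z := by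
    intro z
    have := (hasDerivAt_id z).add ((hasDerivAt_pow (j+1) z).const_mul (ε / (j + 1)))
    have he : 1 + ε / (j + 1) * (((j + 1 : ℕ) : ℂ) * z ^ (j + 1 - 1)) = 1 + ε * z ^ j := by
      rw [← mul_assoc]
      push_cast
      rw [div_mul_cancel₀ _ hj1]
    rw [he] at this
    exact this
  refine PsiS_intro ⟨?_, ?_, ?_, ?_⟩ ?_ ?_ ?_
  · exact fun z _ => (hder z).differentiableAt.differentiableWithinAt
  · intro z hz w hw h
    simp only [Disc, mem_ball_zero_iff] at hz hw
    by_contra hne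
    have h1 := (Commute.all z w).geom_sum₂_mul (j + 1)
    have h2 : (z - w) * (1 + ε / (j+1) * ∑ i ∈ Finset.range (j + 1), z ^ i * w ^ (j + 1 - 1 - i)) = 0 := by
      have h' : (z + ε / (j + 1) * z ^ (j + 1)) - (w + ε / (j + 1) * w ^ (j + 1)) = 0 :=
        sub_eq_zero.2 h
      rw [← h']
      linear_combination (ε / (j+1)) * h1
    have h3 := (mul_eq_zero.1 h2).resolve_left (sub_ne_zero.2 hne)
    have h4 : ‖∑ i ∈ Finset.range (j + 1), z ^ i * w ^ (j + 1 - 1 - i)‖ ≤ j + 1 := by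
      refine (norm_sum_le_of_le _ (f := fun i => z ^ i * w ^ (j + 1 - 1 - i)) (n := fun _ => 1) ?_).trans (by simp)
      intro i _
      rw [norm_mul, norm_pow, norm_pow]
      exact mul_le_one₀ (pow_le_one₀ (norm_nonneg _) hz.le) (by positivity)
        (pow_le_one₀ (norm_nonneg _) hw.le)
    have h5 : ‖ε / (j+1) * ∑ i ∈ Finset.range (j + 1), z ^ i * w ^ (j + 1 - 1 - i)‖ = 1 := by
      rw [show ε / (j+1) * ∑ i ∈ Finset.range (j + 1), z ^ i * w ^ (j + 1 - 1 - i) = -1 by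
        linear_combination h3]
      simp
    rw [norm_mul, norm_div] at h5
    have h6 : ‖(j + 1 : ℂ)‖ = (j + 1 : ℝ) := by
      have : ((j + 1 : ℕ) : ℂ) = (j + 1 : ℂ) := by push_cast; rfl
      rw [← this, Complex.norm_natCast]; push_cast; rfl
    rw [h6] at h5
    have h7 : ‖ε‖ / (j + 1) * ‖∑ i ∈ Finset.range (j + 1), z ^ i * w ^ (j + 1 - 1 - i)‖
        ≤ ‖ε‖ / (j+1) * (j + 1) := by gcongr
    rw [div_mul_cancel₀ _ (by positivity)] at h7
    linarith
  · simp
  · rw [(hder 0).deriv]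
    simp [show j ≠ 0 by omega]
  · exact sqrt_diff.comp (f := fun z => ε * z ^ j) (by fun_prop) (maps_eps hε)
  · simp [show j ≠ 0 by omega]
  · intro z _
    rw [(hder z).deriv]
    have := Complex.cpow_nat_inv_pow (1 + ε * z ^ j) (n := 2) (by norm_num)
    exact_mod_cast this

theorem L_zero {L : (En 2 → En 2) → ℂ} (hL : IsContinuousLinearFunctional L) : L 0 = 0 := by
  simpa using hL.2.1 0 0

theorem L_EE_add {L : (En 2 → En 2) → ℂ} (hL : IsContinuousLinearFunctional L)
    (a b a' b' : ℂ → ℂ) :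
    L (EE (fun z => a z + a' z) (fun z => b z + b' z)) = L (EE a b) + L (EE a' b') := by
  rw [← hL.1, ← EE_add]; rfl

theorem L_EE_smul {L : (En 2 → En 2) → ℂ} (hL : IsContinuousLinearFunctional L)
    (c : ℂ) (a b : ℂ → ℂ) :
    L (EE (fun z => c * a z) (fun z => c * b z)) = c * L (EE a b) := by
  rw [← hL.2.1, ← EE_smul]; rfl

theorem L_EE_split {L : (En 2 → En 2) → ℂ} (hL : IsContinuousLinearFunctional L)
    (a b : ℂ → ℂ) :
    L (EE a b) = L (EE a 0) + L (EE 0 b) := by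
  rw [← hL.1, ← EE_add]; simp

theorem L_EE_sum {L : (En 2 → En 2) → ℂ} (hL : IsContinuousLinearFunctional L)
    (b : ℕ → ℂ → ℂ) (c : ℕ → ℂ) (N : ℕ) :
    L (EE 0 (fun z => ∑ m ∈ Finset.range N, c m * b m z)) =
      ∑ m ∈ Finset.range N, c m * L (EE 0 (b m)) := by
  induction N with
  | zero =>
    simp only [Finset.range_zero, Finset.sum_empty]
    have := L_EE_smul hL 0 0 0
    simpa [Pi.zero_def] using this
  | succ N ih =>
    simp only [Finset.sum_range_succ]
    rw [← ih, ← L_EE_smul hL, ← L_EE_add hL]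
    congr 1
    simp [Pi.zero_def]

theorem L_EE_sum' {L : (En 2 → En 2) → ℂ} (hL : IsContinuousLinearFunctional L)
    (b : ℕ → ℂ → ℂ) (c : ℕ → ℂ) (N : ℕ) :
    L (EE (fun z => ∑ m ∈ Finset.range N, c m * b m z) 0) =
      ∑ m ∈ Finset.range N, c m * L (EE (b m) 0) := by
  induction N with
  | zero =>
    simp only [Finset.range_zero, Finset.sum_empty]
    have := L_EE_smul hL 0 0 0
    simpa [Pi.zero_def] using this
  | succ N ih =>
    simp only [Finset.sum_range_succ]
    rw [← ih, ← L_EE_smul hL, ← L_EE_add hL]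
    congr 1
    simp [Pi.zero_def]

theorem test_tendsto {L : (En 2 → En 2) → ℂ} (hL : IsContinuousLinearFunctional L)
    {ε : ℂ} (hε : ‖ε‖ < 1) (j : ℕ) :
    Tendsto (fun N => L (EE (fun z => z) 0) + ε / (j + 1) * L (EE (fun z => z ^ (j + 1)) 0)
      + ∑ m ∈ Finset.range N, (cc m * ε ^ m) * L (EE 0 (fun z => z ^ (j * m)))) atTop
    (nhds (L (EE (fun z => z + ε / (j + 1) * z ^ (j + 1))
      (fun z => (1 + ε * z ^ j) ^ (2⁻¹ : ℂ))))) := by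
  have h1 : TendstoLocallyUniformlyOn
      (fun N (z : ℂ) => ∑ m ∈ Finset.range N, (cc m * ε ^ m) * z ^ (j * m))
      (fun z => (1 + ε * z ^ j) ^ (2⁻¹ : ℂ)) atTop Disc := by
    have := sqrt_series.comp (fun z => ε * z ^ j) (maps_eps hε (j := j)) (by fun_prop)
    refine this.congr ?_
    intro N z _
    simp only [Function.comp]
    refine Finset.sum_congr rfl fun m _ => ?_
    rw [mul_pow, pow_mul]; ring
  have h2 : TendstoLocallyUniformlyOn (fun (_ : ℕ) (z : ℂ) => z + ε / (j + 1) * z ^ (j + 1))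
      (fun z : ℂ => z + ε / (j + 1) * z ^ (j + 1)) atTop Disc := by
    rw [Metric.tendstoLocallyUniformlyOn_iff]
    intro δ hδ x _
    exact ⟨Disc, self_mem_nhdsWithin, Eventually.of_forall fun k y _ => by simpa using hδ⟩
  have h3 := hL.2.2 _ _ (fun k => EE_diff (by fun_prop) (by fun_prop))
    (EE_diff (by fun_prop) (sqrt_diff.comp (f := fun z => ε * z ^ j) (by fun_prop) (maps_eps hε)))
    (EE_tendsto h2 h1)
  refine h3.congr fun N => ?_
  rw [L_EE_split hL, L_EE_sum hL, ← L_EE_smul hL, ← L_EE_add hL]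
  congr 3
  simp [Pi.zero_def]

theorem key_coeffs {L : (En 2 → En 2) → ℂ} (hL : IsContinuousLinearFunctional L)
    (hc : ∀ F ∈ PsiS, ∀ G ∈ PsiS, (L F).re = (L G).re) :
    (∀ m, 2 ≤ m → L (EE 0 (fun z => z ^ m)) = 0) ∧
    (∀ n, 3 ≤ n → L (EE (fun z => z ^ n) 0) = 0) ∧
    L (EE (fun z => z ^ 2) (fun z => z)) = 0 := by
  have h0 : ∀ ε : ℂ, ‖ε‖ < 1 → (L (EE (fun z => z + ε / (1 + 1) * z ^ (1 + 1))
      (fun z => (1 + ε * z ^ 1) ^ (2⁻¹ : ℂ)))).re = (L (EE (fun z => z + 0 / (1 + 1) * z ^ (1 + 1))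
      (fun z => (1 + 0 * z ^ 1) ^ (2⁻¹ : ℂ)))).re := by
    intro ε hε
    have h1 := test_mem hε (j := 1) le_rfl
    have h2 := test_mem (ε := 0) (by simp) (j := 1) le_rfl
    exact_mod_cast hc _ h1 _ h2
  set e : ℕ → ℂ := fun m => cc m * L (EE 0 (fun z => z ^ m)) +
    (if m = 0 then L (EE (fun z => z) 0) else 0) +
    (if m = 1 then 2⁻¹ * L (EE (fun z => z ^ 2) 0) else 0) with he
  have he0 : ∀ m, 1 ≤ m → e m = 0 := by
    refine coeff_zero_of_re_const (fun ε hε => ?_) h0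
    have h1 := test_tendsto hL hε 1
    simp only [Nat.cast_one] at h1
    refine h1.congr' ?_
    filter_upwards [eventually_ge_atTop 2] with N hN
    have hs : ∀ N, ∑ m ∈ Finset.range (N + 2), e m * ε ^ m =
        L (EE (fun z => z) 0) + ε / (1 + 1) * L (EE (fun z => z ^ (1 + 1)) 0)
      + ∑ m ∈ Finset.range (N + 2), (cc m * ε ^ m) * L (EE 0 (fun z => z ^ (1 * m))) := by
      intro N
      simp only [he, add_mul, Finset.sum_add_distrib, ite_mul, zero_mul, one_mul]
      rw [Finset.sum_ite_eq', Finset.sum_ite_eq']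
      simp
      rw [Finset.sum_congr rfl (fun m _ => mul_right_comm (cc m) (L (EE 0 fun z => z ^ m)) (ε ^ m))]
      norm_num
      ring
    obtain ⟨k, rfl⟩ := Nat.exists_eq_add_of_le' hN
    exact (hs k).symm
  have hA : ∀ m, 2 ≤ m → L (EE 0 (fun z => z ^ m)) = 0 := by
    intro m hm
    have := he0 m (by omega)
    simp only [he, show m ≠ 0 by omega, show m ≠ 1 by omega, if_false, add_zero] at this
    exact (mul_eq_zero.1 this).resolve_left (cc_ne_zero m)
  refine ⟨hA, ?_, ?_⟩
  · intro n hn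
    obtain ⟨j, rfl⟩ : ∃ j, n = j + 1 := ⟨n - 1, by omega⟩
    have hj1 : (j + 1 : ℝ) ≠ 0 := by positivity
    set X := L (EE (fun z => z ^ (j + 1)) 0) with hX
    have hval : ∀ ε : ℂ, ‖ε‖ < 1 → L (EE (fun z => z + ε / (j + 1) * z ^ (j + 1))
      (fun z => (1 + ε * z ^ j) ^ (2⁻¹ : ℂ))) = L (EE (fun z => z) 0) + ε / (j + 1) * X
        + L (EE 0 (fun _ => 1)) := by
      intro ε hε
      refine tendsto_nhds_unique (test_tendsto hL hε j) ?_
      refine tendsto_const_nhds.congr' ?_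
      filter_upwards [eventually_ge_atTop 1] with N hN
      obtain ⟨k, rfl⟩ := Nat.exists_eq_add_of_le' hN
      rw [Finset.sum_range_succ', Finset.sum_eq_zero]
      · simp [cc_zero, hX]
      · intro m _
        rw [hA _ (by nlinarith), mul_zero]
    have hre : ∀ ε : ℂ, ‖ε‖ < 1 → (ε / (j + 1) * X).re = 0 := by
      intro ε hε
      have h1 := test_mem hε (j := j) (by omega)
      have h2 := test_mem (ε := 0) (by simp) (j := j) (by omega)
      have h3 := hc _ h1 _ h2
      rw [hval ε hε, hval 0 (by simp)] at h3
      simpa using h3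
    have hc1 : ((2⁻¹ : ℝ) : ℂ) / (j + 1) = ((2⁻¹ / (j + 1) : ℝ) : ℂ) := by push_cast; ring
    have h1 := hre ((2⁻¹ : ℝ) : ℂ) (by rw [Complex.norm_real]; norm_num)
    have h2 := hre (((2⁻¹ : ℝ) : ℂ) * Complex.I) (by rw [norm_mul, Complex.norm_real]; norm_num)
    rw [hc1, Complex.re_ofReal_mul] at h1
    rw [mul_div_right_comm, hc1, mul_assoc, Complex.re_ofReal_mul] at h2
    have h3 : (2⁻¹ / (j + 1) : ℝ) ≠ 0 := by positivity
    apply Complex.ext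
    · exact (mul_eq_zero.1 h1).resolve_left h3
    · have := (mul_eq_zero.1 h2).resolve_left h3
      simpa using this
  · have := he0 1 le_rfl
    simp only [he, cc_one, one_ne_zero, if_false, if_true, add_zero, pow_one] at this
    rw [L_EE_split hL]
    linear_combination 2 * this

theorem mob_key (a w : ℂ) :
    Complex.normSq (1 + (starRingEnd ℂ) a * w) - Complex.normSq (w + a) =
      (1 - Complex.normSq a) * (1 - Complex.normSq w) := by
  simp [Complex.normSq_apply]
  ring

theorem mob_den {a w : ℂ} (ha : ‖a‖ < 1) (hw : ‖w‖ < 1) : 1 + (starRingEnd ℂ) a * w ≠ 0 := by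
  intro h
  have h1 : ‖(starRingEnd ℂ) a * w‖ = 1 := by
    rw [show (starRingEnd ℂ) a * w = -1 by linear_combination h]; simp
  rw [norm_mul, RCLike.norm_conj] at h1
  nlinarith [norm_nonneg a, norm_nonneg w]

theorem mob_maps {a w : ℂ} (ha : ‖a‖ < 1) (hw : ‖w‖ < 1) :
    ‖(w + a) / (1 + (starRingEnd ℂ) a * w)‖ < 1 := by
  rw [norm_div, div_lt_one (norm_pos_iff.2 (mob_den ha hw))]
  have h := mob_key a w
  simp only [Complex.normSq_eq_norm_sq] at h
  have h1 : ‖a‖ ^ 2 < 1 := by nlinarith [norm_nonneg a]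
  have h2 : ‖w‖ ^ 2 < 1 := by nlinarith [norm_nonneg w]
  refine lt_of_pow_lt_pow_left₀ 2 (norm_nonneg _) ?_
  nlinarith [mul_pos (sub_pos.2 h1) (sub_pos.2 h2)]

theorem mob_deriv {a w : ℂ} (ha : ‖a‖ < 1) (hw : ‖w‖ < 1) :
    HasDerivAt (fun w : ℂ => (w + a) / (1 + (starRingEnd ℂ) a * w))
      ((1 - (starRingEnd ℂ) a * a) / (1 + (starRingEnd ℂ) a * w) ^ 2) w := by
  have h1 : HasDerivAt (fun w : ℂ => w + a) 1 w := (hasDerivAt_id w).add_const a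
  have h2 : HasDerivAt (fun w : ℂ => 1 + (starRingEnd ℂ) a * w) ((starRingEnd ℂ) a) w := by
    simpa using ((hasDerivAt_id w).const_mul ((starRingEnd ℂ) a)).const_add 1
  have h3 := h1.fun_div h2 (mob_den ha hw)
  have he : (1 * (1 + (starRingEnd ℂ) a * w) - (w + a) * (starRingEnd ℂ) a) =
      1 - (starRingEnd ℂ) a * a := by ring
  rwa [he] at h3

theorem one_sub_conj (a : ℂ) : 1 - (starRingEnd ℂ) a * a = ((1 - ‖a‖ ^ 2 : ℝ) : ℂ) := by
  rw [← Complex.normSq_eq_conj_mul_self, Complex.normSq_eq_norm_sq]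
  push_cast; rfl

theorem schwarz_pick {v : ℂ → ℂ} (hv : DifferentiableOn ℂ v Disc) (hm : MapsTo v Disc Disc)
    {z : ℂ} (hz : z ∈ Disc) : ‖deriv v z‖ * (1 - ‖z‖ ^ 2) ≤ 1 - ‖v z‖ ^ 2 := by
  have hz1 : ‖z‖ < 1 := by simpa [Disc] using hz
  have hb1 : ‖v z‖ < 1 := by simpa [Disc] using hm hz
  have hb2 : ‖-v z‖ < 1 := by simpa using hb1
  set M : ℂ → ℂ := fun w => (w + z) / (1 + (starRingEnd ℂ) z * w) with hM
  set N : ℂ → ℂ := fun w => (w + -v z) / (1 + (starRingEnd ℂ) (-v z) * w) with hN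
  have hM0 : M 0 = z := by simp [hM]
  have hN0 : N (v z) = 0 := by simp [hN]
  have hMm : ∀ w, ‖w‖ < 1 → ‖M w‖ < 1 := fun w hw => mob_maps hz1 hw
  have hd : ∀ w, ‖w‖ < 1 → HasDerivAt (fun w => N (v (M w)))
      ((1 - (starRingEnd ℂ) (-v z) * (-v z)) / (1 + (starRingEnd ℂ) (-v z) * v (M w)) ^ 2 *
        (deriv v (M w) * ((1 - (starRingEnd ℂ) z * z) / (1 + (starRingEnd ℂ) z * w) ^ 2))) w := by
    intro w hw
    have h1 : HasDerivAt M _ w := mob_deriv hz1 hw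
    have hMw : M w ∈ Disc := by simpa [Disc] using hMm w hw
    have h2 : HasDerivAt v _ (M w) :=
      (hv.differentiableAt (isOpen_ball.mem_nhds hMw)).hasDerivAt
    have hvM : ‖v (M w)‖ < 1 := by simpa [Disc] using hm hMw
    have h3 : HasDerivAt N _ (v (M w)) := mob_deriv hb2 hvM
    exact h3.comp w (h2.comp w h1)
  have hS := Complex.norm_deriv_le_one_of_mapsTo_ball (f := fun w => N (v (M w))) (c := 0) (R := 1)
    (fun w hw => (hd w (by simpa using hw)).differentiableAt.differentiableWithinAt) (by
      intro w hw
      have hMw : M w ∈ Disc := by simpa [Disc] using hMm w (by simpa using hw)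
      have hvM : ‖v (M w)‖ < 1 := by simpa [Disc] using hm hMw
      have h3 : ‖N (v (M w))‖ < 1 := mob_maps hb2 hvM
      simpa [hM0, hN0] using h3.le) one_pos
  rw [(hd 0 (by simp)).deriv, hM0] at hS
  have e1 : 1 + (starRingEnd ℂ) (-v z) * v z = ((1 - ‖v z‖ ^ 2 : ℝ) : ℂ) := by
    rw [← one_sub_conj]; simp; ring
  have e2 : 1 - (starRingEnd ℂ) (-v z) * (-v z) = ((1 - ‖v z‖ ^ 2 : ℝ) : ℂ) := by
    rw [one_sub_conj, norm_neg]
  rw [e1, e2, one_sub_conj] at hS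
  have p1 : 0 < 1 - ‖v z‖ ^ 2 := by nlinarith [norm_nonneg (v z)]
  have p2 : 0 < 1 - ‖z‖ ^ 2 := by nlinarith [norm_nonneg z]
  simp only [mul_zero, add_zero, one_pow, div_one, norm_mul, norm_div, norm_pow,
    Complex.norm_real, Real.norm_eq_abs, abs_of_pos p1, abs_of_pos p2] at hS
  have e3 : (1 - ‖v z‖ ^ 2) / (1 - ‖v z‖ ^ 2) ^ 2 = (1 - ‖v z‖ ^ 2)⁻¹ := by
    field_simp
  rw [e3, inv_mul_le_iff₀ p1, mul_one] at hS
  exact hS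

theorem V_maps {v β : ℂ → ℂ} (hv : DifferentiableOn ℂ v Disc) (hm : MapsTo v Disc Disc)
    (hβ : ∀ z ∈ Disc, β z ^ 2 = deriv v z) : MapsTo (EE v β) (Ball 2) (Ball 2) := by
  intro z hz
  have h0 := coord0_mem hz
  have h1 := schwarz_pick hv hm h0
  rw [mem_Ball2] at hz ⊢
  rw [EE_zero_apply, EE_one_apply, norm_mul, mul_pow, ← norm_pow (β _), hβ _ h0]
  have hb1 : ‖v (z 0)‖ < 1 := by simpa [Disc] using hm h0
  have p1 : 0 < 1 - ‖v (z 0)‖ ^ 2 := by nlinarith [norm_nonneg (v (z 0))]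
  rcases (norm_nonneg (deriv v (z 0))).eq_or_lt with h | h
  · rw [← h]; linarith
  · nlinarith

theorem tlu_mul {w G : ℂ → ℂ} {g : ℕ → ℂ → ℂ} (hw : DifferentiableOn ℂ w Disc)
    (h : TendstoLocallyUniformlyOn g G atTop Disc) :
    TendstoLocallyUniformlyOn (fun k z => w z * g k z) (fun z => w z * G z) atTop Disc := by
  rw [Metric.tendstoLocallyUniformlyOn_iff] at h ⊢
  intro ε hε x hx
  have hC : (0 : ℝ) < ‖w x‖ + 1 := by positivity
  obtain ⟨s, hs, hsa⟩ := h (ε / (‖w x‖ + 1)) (by positivity) x hx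
  have hcont := (hw.continuousOn x hx).norm
  have hev : ∀ᶠ y in nhdsWithin x Disc, ‖w y‖ < ‖w x‖ + 1 :=
    hcont.eventually (gt_mem_nhds (by linarith))
  refine ⟨s ∩ {y | ‖w y‖ < ‖w x‖ + 1}, inter_mem hs hev, ?_⟩
  filter_upwards [hsa] with k hk y hy
  have h1 := hk y hy.1
  have h2 : ‖w y‖ < ‖w x‖ + 1 := hy.2
  rw [dist_eq_norm] at h1 ⊢
  rw [← mul_sub, norm_mul]
  rw [lt_div_iff₀ hC] at h1
  nlinarith [norm_nonneg (w y), norm_nonneg (G y - g k y)]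

theorem tlu_const (a : ℂ → ℂ) :
    TendstoLocallyUniformlyOn (fun (_ : ℕ) => a) a atTop Disc := by
  rw [Metric.tendstoLocallyUniformlyOn_iff]
  intro δ hδ x _
  exact ⟨Disc, self_mem_nhdsWithin, Eventually.of_forall fun k y _ => by simpa using hδ⟩

theorem vanish_fst {L : (En 2 → En 2) → ℂ} (hL : IsContinuousLinearFunctional L)
    {v w G : ℂ → ℂ} (hv : DifferentiableOn ℂ v Disc) (hinj : InjOn v Disc)
    (hw : DifferentiableOn ℂ w Disc) (hG : DifferentiableOn ℂ G Disc)
    (h : ∀ n : ℕ, L (EE (fun z => w z * v z ^ n) 0) = 0) :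
    L (EE (fun z => w z * G z) 0) = 0 := by
  obtain ⟨p, hp⟩ := exists_poly_seq hv hinj hG
  have hpd : ∀ k, DifferentiableOn ℂ (fun z => w z * (p k).eval (v z)) Disc := fun k =>
    hw.mul ((p k).differentiable.comp_differentiableOn hv)
  have h1 := hL.2.2 (fun k => EE (fun z => w z * (p k).eval (v z)) 0) _
    (fun k => EE_diff (hpd k) (differentiableOn_const 0))
    (EE_diff (hw.mul hG) (differentiableOn_const 0)) (EE_tendsto (tlu_mul hw hp) (tlu_const 0))
  refine tendsto_nhds_unique h1 ?_
  refine tendsto_const_nhds.congr fun k => ?_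
  have h2 := L_EE_sum' hL (fun n z => w z * v z ^ n) (p k).coeff ((p k).natDegree + 1)
  simp only [h, mul_zero, Finset.sum_const_zero] at h2
  rw [← h2]
  congr 2
  funext z
  rw [Polynomial.eval_eq_sum_range, Finset.mul_sum]
  exact Finset.sum_congr rfl fun n _ => by ring

theorem vanish_snd {L : (En 2 → En 2) → ℂ} (hL : IsContinuousLinearFunctional L)
    {v w G : ℂ → ℂ} (hv : DifferentiableOn ℂ v Disc) (hinj : InjOn v Disc)
    (hw : DifferentiableOn ℂ w Disc) (hG : DifferentiableOn ℂ G Disc)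
    (h : ∀ n : ℕ, L (EE 0 (fun z => w z * v z ^ n)) = 0) :
    L (EE 0 (fun z => w z * G z)) = 0 := by
  obtain ⟨p, hp⟩ := exists_poly_seq hv hinj hG
  have hpd : ∀ k, DifferentiableOn ℂ (fun z => w z * (p k).eval (v z)) Disc := fun k =>
    hw.mul ((p k).differentiable.comp_differentiableOn hv)
  have h1 := hL.2.2 (fun k => EE 0 (fun z => w z * (p k).eval (v z))) _
    (fun k => EE_diff (differentiableOn_const 0) (hpd k))
    (EE_diff (differentiableOn_const 0) (hw.mul hG)) (EE_tendsto (tlu_const 0) (tlu_mul hw hp))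
  refine tendsto_nhds_unique h1 ?_
  refine tendsto_const_nhds.congr fun k => ?_
  have h2 := L_EE_sum hL (fun n z => w z * v z ^ n) (p k).coeff ((p k).natDegree + 1)
  simp only [h, mul_zero, Finset.sum_const_zero] at h2
  rw [← h2]
  congr 2
  funext z
  rw [Polynomial.eval_eq_sum_range, Finset.mul_sum]
  exact Finset.sum_congr rfl fun n _ => by ring

theorem zero_mem_Disc : (0 : ℂ) ∈ Disc := by simp [Disc]

theorem Disc_open : IsOpen Disc := isOpen_ball

theorem div_v {v H : ℂ → ℂ} (hv : DifferentiableOn ℂ v Disc) (hinj : InjOn v Disc)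
    (hv0 : v 0 = 0) (hH : DifferentiableOn ℂ H Disc) (hH0 : H 0 = 0) :
    ∃ G, DifferentiableOn ℂ G Disc ∧ ∀ z ∈ Disc, H z = v z * G z := by
  have hn : Disc ∈ nhds (0:ℂ) := Disc_open.mem_nhds zero_mem_Disc
  have hd1 := (Complex.differentiableOn_dslope hn).2 hv
  have hd2 := (Complex.differentiableOn_dslope hn).2 hH
  have e1 : ∀ z, v z = z * dslope v 0 z := by
    intro z
    have := sub_smul_dslope v 0 z
    simpa [hv0] using this.symm
  have e2 : ∀ z, H z = z * dslope H 0 z := by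
    intro z
    have := sub_smul_dslope H 0 z
    simpa [hH0] using this.symm
  have hne : ∀ z ∈ Disc, dslope v 0 z ≠ 0 := by
    intro z hz
    by_cases h : z = 0
    · subst h
      rw [dslope_same]
      exact deriv_ne_zero_of_injOn Disc_open hv hinj zero_mem_Disc
    · intro h0
      have h1 := e1 z
      rw [h0, mul_zero] at h1
      exact h (hinj hz zero_mem_Disc (by rw [h1, hv0]))
  refine ⟨fun z => dslope H 0 z / dslope v 0 z, hd2.div hd1 hne, fun z hz => ?_⟩
  have := hne z hz
  rw [e2 z, e1 z]
  simp only
  field_simp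

theorem deriv_mul_v {v G : ℂ → ℂ} (hv : DifferentiableOn ℂ v Disc)
    (hv0 : v 0 = 0) (hG : DifferentiableOn ℂ G Disc) {H : ℂ → ℂ} 
    (h : ∀ z ∈ Disc, H z = v z * G z) : deriv H 0 = deriv v 0 * G 0 := by
  have hn : Disc ∈ nhds (0:ℂ) := Disc_open.mem_nhds zero_mem_Disc
  have h1 := (hv.differentiableAt hn).hasDerivAt.mul (hG.differentiableAt hn).hasDerivAt
  rw [hv0, zero_mul, add_zero] at h1
  have h2 : HasDerivAt H (deriv v 0 * G 0) 0 := by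
    refine h1.congr_of_eventuallyEq ?_
    filter_upwards [hn] with z hz
    exact h z hz
  exact h2.deriv

theorem eq_base {L : (En 2 → En 2) → ℂ} (hL : IsContinuousLinearFunctional L)
    {v α : ℂ → ℂ} {c : ℂ} (hv : DifferentiableOn ℂ v Disc) (hinj : InjOn v Disc)
    (hv0 : v 0 = 0) (hα : DifferentiableOn ℂ α Disc) (hα0 : α 0 = 1)
    (hαne : ∀ z ∈ Disc, α z ≠ 0) (hc : c * deriv v 0 = 1)
    (hA : ∀ n, 3 ≤ n → L (EE (fun z => v z ^ n) 0) = 0)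
    (hB : ∀ n, 2 ≤ n → L (EE 0 (fun z => α z * v z ^ n)) = 0)
    (hC : L (EE (fun z => c * v z ^ 2) (fun z => α z * v z)) = 0)
    {h k : ℂ → ℂ} (hh : ClassS1 h) (hk : DifferentiableOn ℂ k Disc)
    (hk0 : k 0 = 1) (hkh : ∀ z ∈ Disc, k z ^ 2 = deriv h z) :
    L (EE h k) = L (EE (fun z => z) (fun _ => 1)) := by
  obtain ⟨hhd, -, hh0, hh1⟩ := hh
  have hn : Disc ∈ nhds (0:ℂ) := Disc_open.mem_nhds zero_mem_Disc
  have hv' : deriv v 0 ≠ 0 := deriv_ne_zero_of_injOn Disc_open hv hinj zero_mem_Disc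
  have hDv : DifferentiableOn ℂ (deriv v) Disc := hv.deriv Disc_open
  obtain ⟨G1, hG1, e1⟩ := div_v hv hinj hv0 (H := fun z => h z - z)
    (hhd.sub differentiableOn_id) (by simp [hh0])
  have hd0 := deriv_mul_v hv hv0 hG1 e1
  have hd0' : deriv (fun z => h z - z) 0 = 0 := by
    have := ((hhd.differentiableAt hn).hasDerivAt.sub (hasDerivAt_id 0)).deriv
    rw [hh1, sub_self] at this
    exact this
  have hG10 : G1 0 = 0 := by
    rw [hd0'] at hd0
    exact (mul_eq_zero.1 hd0.symm).resolve_left hv'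
  obtain ⟨K, hK, e2⟩ := div_v hv hinj hv0 hG1 hG10
  set b := K 0 with hb
  obtain ⟨M, hM, e3⟩ := div_v hv hinj hv0 (H := fun z => K z - b)
    (hK.sub (differentiableOn_const b)) (by simp [hb])
  have hDM : DifferentiableOn ℂ (deriv M) Disc := hM.deriv Disc_open
  have e4 : ∀ z ∈ Disc, h z = z + b * v z ^ 2 + v z ^ 3 * M z := by
    intro z hz
    linear_combination e1 z hz + v z * e2 z hz + v z ^ 2 * e3 z hz
  obtain ⟨P, hP, e5⟩ := div_v hv hinj hv0 (H := fun z => k z - 1)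
    (hk.sub (differentiableOn_const 1)) (by simp [hk0])
  have e6 : ∀ z ∈ Disc, deriv h z = 1 + 2 * b * v z * deriv v z +
      v z ^ 2 * (3 * deriv v z * M z + v z * deriv M z) := by
    intro z hz
    have hnz : Disc ∈ nhds z := Disc_open.mem_nhds hz
    have hvz := (hv.differentiableAt hnz).hasDerivAt
    have hMz := (hM.differentiableAt hnz).hasDerivAt
    have h1 := ((hasDerivAt_id z).add ((hvz.pow 2).const_mul b)).add ((hvz.pow 3).mul hMz)
    have h2 := h1.congr_of_eventuallyEq (f₁ := h) (by
      filter_upwards [hnz] with y hy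
      exact e4 y hy)
    rw [h2.deriv]
    simp
    ring
  have e7 : P 0 = b * deriv v 0 := by
    have hQ : DifferentiableOn ℂ (fun z => P z * (k z + 1) - 2 * b * deriv v z
        - v z * (3 * deriv v z * M z + v z * deriv M z)) Disc := by
      fun_prop
    have h1 := deriv_mul_v (H := fun _ => 0) hv hv0 hQ (by
      intro z hz
      have := hkh z hz
      rw [e6 z hz] at this
      linear_combination this.symm + (k z + 1) * e5 z hz)
    simp only [deriv_const, hk0, hv0] at h1
    have h2 := (mul_eq_zero.1 h1.symm).resolve_left hv'
    linear_combination h2 / 2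
  obtain ⟨Q, hQ, e8⟩ := div_v hv hinj hv0 (H := fun z => P z / α z - b * deriv v 0)
    ((hP.div hα hαne).sub (differentiableOn_const _)) (by simp [hα0, e7])
  have e9 : ∀ z ∈ Disc, k z = 1 + b * deriv v 0 * (α z * v z) + (α z * v z ^ 2) * Q z := by
    intro z hz
    have h1 := e8 z hz
    have h2 := e5 z hz
    have h3 := hαne z hz
    have h4 : P z = α z * (b * deriv v 0 + v z * Q z) := by
      rw [← sub_eq_iff_eq_add'.1 h1]
      field_simp
    rw [h4] at h2
    linear_combination h2
  have r1 : L (EE (fun z => v z ^ 3 * M z) 0) = 0 :=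
    vanish_fst hL hv hinj (hv.pow 3) hM fun n => by
      have := hA (3 + n) (by omega)
      simpa only [pow_add] using this
  have r2 : L (EE 0 (fun z => α z * v z ^ 2 * Q z)) = 0 :=
    vanish_snd hL hv hinj (hα.mul (hv.pow 2)) hQ fun n => by
      have := hB (2 + n) (by omega)
      simpa only [pow_add, mul_assoc] using this
  have r3 := L_EE_smul hL (b * deriv v 0) (fun z => c * v z ^ 2) (fun z => α z * v z)
  rw [hC, mul_zero] at r3
  have r4 := L_EE_add hL (fun z => z) (fun _ => 1) (fun z => b * deriv v 0 * (c * v z ^ 2))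
    (fun z => b * deriv v 0 * (α z * v z))
  have r5 := L_EE_split hL (fun z => v z ^ 3 * M z) (fun z => α z * v z ^ 2 * Q z)
  have r6 := L_EE_add hL (fun z => z + b * deriv v 0 * (c * v z ^ 2))
    (fun z => 1 + b * deriv v 0 * (α z * v z)) (fun z => v z ^ 3 * M z)
    (fun z => α z * v z ^ 2 * Q z)
  rw [r5, r1, r2, r4, r3, add_zero, add_zero, add_zero] at r6
  rw [← r6]
  refine L_EE_congr hL (by fun_prop) (by fun_prop) ?_ ?_
  · intro z hz
    rw [e4 z hz]
    linear_combination (-b * v z ^ 2) * hc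
  · intro z hz
    rw [e9 z hz]

/-- Pull-back of a functional along `(v, β)`. -/
def pull (L : (En 2 → En 2) → ℂ) (c d : ℂ) (v β : ℂ → ℂ) (H : En 2 → En 2) : ℂ :=
  L (fun z => !₂[c * H (EE v β z) 0, d * H (EE v β z) 1])

theorem pull_EE (L : (En 2 → En 2) → ℂ) (c d : ℂ) (v β a b : ℂ → ℂ) :
    pull L c d v β (EE a b) =
      L (EE (fun z => c * a (v z)) (fun z => d * β z * b (v z))) := by
  unfold pull
  congr 1
  funext z
  apply En2_ext
  · simp [EE]
  · simp [EE]; ring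

theorem coord_le (w : En 2) (i : Fin 2) : ‖w i‖ ≤ ‖w‖ := PiLp.norm_apply_le w i

theorem pull_cont {L : (En 2 → En 2) → ℂ} (hL : IsContinuousLinearFunctional L)
    (c d : ℂ) {v β : ℂ → ℂ} (hv : DifferentiableOn ℂ v Disc) (hβ : DifferentiableOn ℂ β Disc)
    (hm : MapsTo (EE v β) (Ball 2) (Ball 2)) :
    IsContinuousLinearFunctional (pull L c d v β) := by
  have hVd := EE_diff hv hβ
  have hdiff : ∀ H : En 2 → En 2, DifferentiableOn ℂ H (Ball 2) →
      DifferentiableOn ℂ (fun z => (!₂[c * H (EE v β z) 0, d * H (EE v β z) 1] : En 2))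
        (Ball 2) := by
    intro H hH
    have h1 : DifferentiableOn ℂ (fun z => H (EE v β z)) (Ball 2) := hH.comp hVd hm
    rw [differentiableOn_euclidean] at h1 ⊢
    intro i
    fin_cases i
    · exact (h1 0).const_mul c
    · exact (h1 1).const_mul d
  refine ⟨?_, ?_, ?_⟩
  · intro H H'
    unfold pull
    rw [← hL.1]
    congr 1
    funext z
    apply En2_ext
    · simp [mul_add]
    · simp [mul_add]
  · intro a H
    unfold pull
    rw [← hL.2.1]
    congr 1
    funext z
    apply En2_ext
    · simp [mul_left_comm]
    · simp [mul_left_comm]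
  · intro H G hH hG hT
    refine hL.2.2 _ _ (fun k => hdiff _ (hH k)) (hdiff _ hG) ?_
    have h1 := hT.comp (EE v β) hm hVd.continuousOn
    rw [Metric.tendstoLocallyUniformlyOn_iff] at h1 ⊢
    intro ε hε x hx
    have hC : (0:ℝ) < ‖c‖ + ‖d‖ + 1 := by positivity
    obtain ⟨s, hs, hs'⟩ := h1 (ε / (‖c‖ + ‖d‖ + 1)) (by positivity) x hx
    refine ⟨s, hs, ?_⟩
    filter_upwards [hs'] with k hk y hy
    have h2 := hk y hy
    simp only [Function.comp] at h2
    rw [dist_eq_norm] at h2 ⊢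
    rw [lt_div_iff₀ hC] at h2
    refine (norm_En2_le _).trans_lt ?_
    have h3 := coord_le (G (EE v β y) - H k (EE v β y)) 0
    have h4 := coord_le (G (EE v β y) - H k (EE v β y)) 1
    simp only [PiLp.sub_apply] at h3 h4 ⊢
    simp only [PiLp.toLp_apply, Matrix.cons_val_zero, Matrix.cons_val_one]
    rw [← mul_sub, ← mul_sub, norm_mul, norm_mul]
    nlinarith [mul_le_mul_of_nonneg_left h3 (norm_nonneg c),
      mul_le_mul_of_nonneg_left h4 (norm_nonneg d),
      norm_nonneg (G (EE v β y) - H k (EE v β y))]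

theorem transfer {L : (En 2 → En 2) → ℂ} (hL : IsContinuousLinearFunctional L)
    {v α : ℂ → ℂ} {c d : ℂ} (hv : DifferentiableOn ℂ v Disc) (hinj : InjOn v Disc)
    (hm : MapsTo v Disc Disc)
    (hv0 : v 0 = 0) (hα : DifferentiableOn ℂ α Disc) (hα0 : α 0 = 1)
    (hαv : ∀ z ∈ Disc, α z ^ 2 = c * deriv v z) (hc0 : c ≠ 0) (hd : d ^ 2 = c)
    (hnc : ∃ g₁ ∈ PsiS, ∃ g₂ ∈ PsiS, (L g₁).re ≠ (L g₂).re)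
    {F G : En 2 → En 2} (hmax : ∀ H ∈ PsiS, (L H).re ≤ (L F).re)
    {φ g : ℂ → ℂ} (hφ : ClassS1 φ) (hg : DifferentiableOn ℂ g Disc) (hg0 : g 0 = 1)
    (hgφ : ∀ z ∈ Disc, g z ^ 2 = deriv φ z)
    (hG : ∀ z ∈ Ball 2, G z 0 = φ (z 0) ∧ G z 1 = z 1 * g (z 0))
    (hF : L F = L (EE (fun z => c * φ (v z)) (fun z => α z * g (v z)))) :
    IsSupportPoint PsiS G := by
  have hd0 : d ≠ 0 := by
    rintro rfl
    apply hc0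
    rw [← hd]; norm_num
  have hv' : ∀ z ∈ Disc, deriv v z ≠ 0 := fun z hz =>
    deriv_ne_zero_of_injOn Disc_open hv hinj hz
  have hαne : ∀ z ∈ Disc, α z ≠ 0 := by
    intro z hz h
    have := hαv z hz
    rw [h] at this
    have h2 : c * deriv v z = 0 := by rw [← this]; norm_num
    exact (mul_ne_zero hc0 (hv' z hz)) h2
  have hc : c * deriv v 0 = 1 := by
    rw [← hαv 0 zero_mem_Disc, hα0, one_pow]
  set β : ℂ → ℂ := fun z => d⁻¹ * α z with hβdef
  have hβ : DifferentiableOn ℂ β Disc := hα.const_mul _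
  have hdβ : ∀ z, d * β z = α z := by
    intro z; simp only [hβdef]; field_simp
  have hmV : MapsTo (EE v β) (Ball 2) (Ball 2) := by
    refine V_maps hv hm fun z hz => ?_
    simp only [hβdef]
    rw [mul_pow, hαv z hz, inv_pow, hd]
    field_simp
  have hL' := pull_cont hL c d hv hβ hmV
  set L' := pull L c d v β with hL'def
  have hpe : ∀ a b : ℂ → ℂ, L' (EE a b) =
      L (EE (fun z => c * a (v z)) (fun z => α z * b (v z))) := by
    intro a b
    rw [hL'def, pull_EE]
    simp only [hdβ]
  have hLG : L' G = L F := by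
    rw [L_RS hL' hφ.1 hg hG, hpe, hF]
  refine ⟨⟨φ, hφ, g, hg, hg0, hgφ, hG⟩, L', hL', ?_, ?_⟩
  · by_contra hcon
    push Not at hcon
    obtain ⟨k1, k2, k3⟩ := key_coeffs hL' hcon
    have hA : ∀ n, 3 ≤ n → L (EE (fun z => v z ^ n) 0) = 0 := by
      intro n hn
      have h1 := k2 n hn
      rw [hpe] at h1
      have h2 := L_EE_smul hL c (fun z => v z ^ n) 0
      simp only [Pi.zero_apply, mul_zero] at h1 h2
      rw [h1] at h2
      exact (mul_eq_zero.1 h2.symm).resolve_left hc0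
    have hB : ∀ n, 2 ≤ n → L (EE 0 (fun z => α z * v z ^ n)) = 0 := by
      intro n hn
      have h1 := k1 n hn
      rw [hpe] at h1
      simp only [Pi.zero_apply, mul_zero] at h1
      exact h1
    rw [hpe] at k3
    obtain ⟨F1, ⟨h1, hs1, q1, hq1, hq10, hqh1, hF1⟩, F2, ⟨h2, hs2, q2, hq2, hq20, hqh2, hF2⟩, hne⟩ := hnc
    apply hne
    rw [L_RS hL hs1.1 hq1 hF1, L_RS hL hs2.1 hq2 hF2,
      eq_base hL hv hinj hv0 hα hα0 hαne hc hA hB k3 hs1 hq1 hq10 hqh1,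
      eq_base hL hv hinj hv0 hα hα0 hαne hc hA hB k3 hs2 hq2 hq20 hqh2]
  · rintro H ⟨h, hs, k, hk, hk0, hkh, hH⟩
    rw [L_RS hL' hs.1 hk hH, hpe, hLG]
    apply hmax
    have hder : ∀ z ∈ Disc, HasDerivAt (fun z => c * h (v z))
        (c * (deriv h (v z) * deriv v z)) z := by
      intro z hz
      have h1 := (hv.differentiableAt (Disc_open.mem_nhds hz)).hasDerivAt
      have h2 := (hs.1.differentiableAt (Disc_open.mem_nhds (hm hz))).hasDerivAt
      exact (h2.comp z h1).const_mul c
    refine PsiS_intro ⟨?_, ?_, ?_, ?_⟩ ?_ ?_ ?_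
    · exact fun z hz => (hder z hz).differentiableAt.differentiableWithinAt
    · intro x hx y hy hxy
      exact hinj hx hy (hs.2.1 (hm hx) (hm hy) (mul_left_cancel₀ hc0 hxy))
    · simp [hv0, hs.2.2.1]
    · rw [(hder 0 zero_mem_Disc).deriv, hv0, hs.2.2.2, one_mul, hc]
    · exact hα.mul (hk.comp hv hm)
    · simp [hα0, hv0, hk0]
    · intro z hz
      rw [(hder z hz).deriv, mul_pow, hαv z hz, hkh _ (hm hz)]
      ring

/-- If F = Ψ(f) is a support point of Ψ(S) and (f_t) is a normalized Loewner
chain on 𝔻 with f₀ = f, then with F_t = eᵗ·Ψ(e^{−t}·f_t) the map e^{−t}·F_t is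
a support point of Ψ(S) for every t ≥ 0. -/
theorem roperSuffridge_support_point_along_chain (f : ℂ → ℂ) (hf : ClassS1 f)
    (F : En 2 → En 2) (hF : IsRoperSuffridge f F)
    (fc : ℝ → ℂ → ℂ) (hchain : IsNormalizedLoewnerChain1 fc) (h0 : fc 0 = f)
    (hsp : IsSupportPoint PsiS F) :
    ∀ t : ℝ, 0 ≤ t → ∀ Ft : En 2 → En 2,
      (∃ G : En 2 → En 2,
        IsRoperSuffridge (fun z => (Real.exp (-t) : ℂ) * fc t z) G ∧
        ∀ z, Ft z = (Real.exp t : ℂ) • G z) →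
      IsSupportPoint PsiS (fun z => (Real.exp (-t) : ℂ) • Ft z) := by
  rintro t ht Ft ⟨G, ⟨gt, hgt, hgt0, hgtφ, hG⟩, hFt⟩
  have hee : (Real.exp (-t) : ℂ) * (Real.exp t : ℂ) = 1 := by
    rw [← Complex.ofReal_mul, ← Real.exp_add]; simp
  have hGeq : (fun z => (Real.exp (-t) : ℂ) • Ft z) = G := by
    funext z
    rw [hFt, smul_smul, hee, one_smul]
  rw [hGeq]
  obtain ⟨hFmem, L, hL, hnc, hmax⟩ := hsp
  obtain ⟨g, hg, hg0, hgf, hFg⟩ := hF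
  obtain ⟨hfd, hfi, hf0, hf1⟩ := hf
  obtain ⟨htd, hti, ht0, ht1⟩ := hchain.1 t ht
  have hsub : f '' Disc ⊆ fc t '' Disc := by
    have := hchain.2 0 t le_rfl ht
    rwa [h0] at this
  generalize hft : fc t = ft at *
  obtain ⟨inv, hinv⟩ := exists_holo_inverse Disc_open htd hti
  set c : ℂ := (Real.exp t : ℂ) with hcdef
  set c' : ℂ := (Real.exp (-t) : ℂ) with hcdef'
  have hc0 : c ≠ 0 := right_ne_zero_of_mul_eq_one hee
  have hc0' : c' ≠ 0 := left_ne_zero_of_mul_eq_one hee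
  set v : ℂ → ℂ := fun z => inv (f z) with hvdef
  have hvx : ∀ z ∈ Disc, v z ∈ Disc ∧ ft (v z) = f z ∧ DifferentiableAt ℂ v z := by
    intro z hz
    obtain ⟨w, hw, hwz⟩ := hsub ⟨z, hz, rfl⟩
    have h1 := hinv w hw
    have h2 : v z = w := by simp only [hvdef]; rw [← hwz]; exact h1.1
    refine ⟨h2 ▸ hw, by rw [h2, hwz], ?_⟩
    have h3 := h1.2
    rw [hwz] at h3
    exact h3.comp z (hfd.differentiableAt (Disc_open.mem_nhds hz))
  have hv : DifferentiableOn ℂ v Disc := fun z hz => (hvx z hz).2.2.differentiableWithinAt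
  have hm : MapsTo v Disc Disc := fun z hz => (hvx z hz).1
  have hinj : InjOn v Disc := by
    intro x hx y hy hxy
    apply hfi hx hy
    rw [← (hvx x hx).2.1, ← (hvx y hy).2.1, hxy]
  have hv0 : v 0 = 0 := by
    refine hti (hm zero_mem_Disc) zero_mem_Disc ?_
    rw [(hvx 0 zero_mem_Disc).2.1, hf0, ht0]
  have hdφ : ∀ z ∈ Disc, deriv (fun z => c' * ft z) z = c' * deriv ft z := by
    intro z hz
    exact ((htd.differentiableAt (Disc_open.mem_nhds hz)).hasDerivAt.const_mul c').deriv
  have hgtne : ∀ z ∈ Disc, gt z ≠ 0 := by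
    intro z hz h
    have h1 := hgtφ z hz
    rw [hdφ z hz, h] at h1
    have h2 : c' * deriv ft z = 0 := by rw [← h1]; norm_num
    exact mul_ne_zero hc0' (deriv_ne_zero_of_injOn Disc_open htd hti hz) h2
  have hdf : ∀ z ∈ Disc, deriv f z = deriv ft (v z) * deriv v z := by
    intro z hz
    have h1 := (hvx z hz).2.2.hasDerivAt
    have h2 := (htd.differentiableAt (Disc_open.mem_nhds (hm hz))).hasDerivAt
    have h3 := (h2.comp z h1).congr_of_eventuallyEq (f₁ := f) (by
      filter_upwards [Disc_open.mem_nhds hz] with y hy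
      exact ((hvx y hy).2.1).symm)
    exact h3.deriv
  set α : ℂ → ℂ := fun z => g z / gt (v z) with hαdef
  have hα : DifferentiableOn ℂ α Disc :=
    hg.div (hgt.comp hv hm) fun z hz => hgtne _ (hm hz)
  have hαv : ∀ z ∈ Disc, α z ^ 2 = c * deriv v z := by
    intro z hz
    have h1 := hgtne _ (hm hz)
    simp only [hαdef]
    rw [div_pow, div_eq_iff (pow_ne_zero 2 h1), hgf z hz, hdf z hz, hgtφ _ (hm hz),
      hdφ _ (hm hz)]
    linear_combination (-deriv ft (v z) * deriv v z) * hee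
  refine transfer hL (c := c) (d := (Real.exp (t / 2) : ℂ)) hv hinj hm hv0 hα
    (by simp [hαdef, hg0, hv0, hgt0]) hαv hc0 ?_ hnc hmax (φ := fun z => c' * ft z)
    ⟨htd.const_mul c', ?_, ?_, ?_⟩ hgt hgt0 hgtφ hG ?_
  · rw [hcdef, ← Complex.ofReal_pow, ← Real.exp_nat_mul]
    congr 2
    push_cast
    ring
  · intro x hx y hy hxy
    exact hti hx hy (mul_left_cancel₀ hc0' hxy)
  · simp [ht0]
  · rw [hdφ 0 zero_mem_Disc, ht1, hee]
  · rw [L_RS hL hfd hg hFg]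
    symm
    refine L_EE_congr hL hfd hg ?_ ?_
    · intro z hz
      rw [(hvx z hz).2.1]
      linear_combination (f z) * hee
    · intro z hz
      simp only [hαdef]
      exact div_mul_cancel₀ _ (hgtne _ (hm hz))

end
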